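/- arXiv:math/0302275 — 2 statements merged into one kernel-verified Lean document; each statement's English description precedes it below -/
import Mathlib

section
/- Let T be a hyponormal bilateral weighted shift on H with nonzero weight sequence (β_n)_{n∈ℤ}, M = lim_{n→+∞} |β_n| and m = lim_{n→−∞} |β_n|. Then: the compression spectrum of T is exactly the open annulus {λ ∈ ℂ : m < |λ| < M} (i.e., the range of λI − T fails to be dense precisely when m < |λ| < M), and the approximate point spectrum of T is exactly the set {λ ∈ ℂ : |λ| = m or |λ| = M}. -/
open Filter Topology

namespace WShift

section
variable {H : Type*} [NormedAddCommGroup H] [InnerProductSpace ℂ H] [CompleteSpace H]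

lemma hasSum_coord (e : HilbertBasis ℤ ℂ H) (x : H) :
    HasSum (fun n => ‖e.repr x n‖ ^ 2) (‖x‖ ^ 2) := by
  have h := lp.hasSum_norm (p := 2) (by norm_num) (e.repr x)
  rw [e.repr.norm_map] at h
  simpa using h

lemma tendsto_coord (e : HilbertBasis ℤ ℂ H) (x : H) :
    Tendsto (fun n => ‖e.repr x n‖) cofinite (𝓝 0) := by
  have h := (hasSum_coord e x).summable.tendsto_cofinite_zero
  have h2 := (Real.continuous_sqrt.tendsto 0).comp h
  simpa [Function.comp_def, Real.sqrt_sq (norm_nonneg _)] using h2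

lemma tendsto_coord_top (e : HilbertBasis ℤ ℂ H) (x : H) :
    Tendsto (fun n => ‖e.repr x n‖) atTop (𝓝 0) :=
  (tendsto_coord e x).mono_left (by rw [Int.cofinite_eq]; exact le_sup_right)

lemma tendsto_coord_bot (e : HilbertBasis ℤ ℂ H) (x : H) :
    Tendsto (fun n => ‖e.repr x n‖) atBot (𝓝 0) :=
  (tendsto_coord e x).mono_left (by rw [Int.cofinite_eq]; exact le_sup_left)

lemma clm_ext (e : HilbertBasis ℤ ℂ H) {F : Type*} [NormedAddCommGroup F] [NormedSpace ℂ F]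
    {A B : H →L[ℂ] F} (h : ∀ n, A (e n) = B (e n)) : A = B := by
  apply ContinuousLinearMap.ext_on (s := Set.range e)
  · have := e.dense_span
    rw [Submodule.dense_iff_topologicalClosure_eq_top]
    exact this
  · rintro _ ⟨n, rfl⟩
    exact h n

lemma ext_coord (e : HilbertBasis ℤ ℂ H) {x y : H} (h : ∀ n, e.repr x n = e.repr y n) :
    x = y := e.repr.injective (lp.ext (funext h))

lemma repr_basis (e : HilbertBasis ℤ ℂ H) (k n : ℤ) :
    e.repr (e k) n = if n = k then 1 else 0 := by
  rw [e.repr_apply_apply]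
  exact orthonormal_iff_ite.mp e.orthonormal n k

lemma coord_T (e : HilbertBasis ℤ ℂ H) (β : ℤ → ℂ) (T : H →L[ℂ] H)
    (hT : ∀ n : ℤ, T (e n) = β n • e (n + 1)) (x : H) (n : ℤ) :
    e.repr (T x) (n + 1) = β n * e.repr x n := by
  have : (innerSL ℂ (e (n+1))).comp T = β n • innerSL ℂ (e n) := by
    apply clm_ext e
    intro k
    have h1 := orthonormal_iff_ite.mp e.orthonormal (n+1) (k+1)
    have h2 := orthonormal_iff_ite.mp e.orthonormal n k
    simp only [ContinuousLinearMap.comp_apply, hT, map_smul, innerSL_apply_apply,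
      ContinuousLinearMap.smul_apply, h1, h2, smul_eq_mul, add_left_inj]
    by_cases h : n = k <;> simp [h]
  have := congrArg (fun f => f x) this
  simpa [e.repr_apply_apply] using this

lemma hasSum_T (e : HilbertBasis ℤ ℂ H) (β : ℤ → ℂ) (T : H →L[ℂ] H)
    (hT : ∀ n : ℤ, T (e n) = β n • e (n + 1)) (x : H) :
    HasSum (fun n => ‖β n‖ ^ 2 * ‖e.repr x n‖ ^ 2) (‖T x‖ ^ 2) := by
  have h := (Equiv.addRight (1:ℤ)).hasSum_iff.mpr (hasSum_coord e (T x))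
  simpa [Function.comp_def, coord_T e β T hT, mul_pow] using h

lemma lower_T (e : HilbertBasis ℤ ℂ H) (β : ℤ → ℂ) (T : H →L[ℂ] H)
    (hT : ∀ n : ℤ, T (e n) = β n • e (n + 1)) (x : H) (b : ℝ) (hb : 0 ≤ b)
    (h : ∀ n, e.repr x n ≠ 0 → b ≤ ‖β n‖) : b * ‖x‖ ≤ ‖T x‖ := by
  apply le_of_sq_le_sq _ (norm_nonneg _)
  rw [mul_pow]
  refine hasSum_le (fun n => ?_) ((hasSum_coord e x).mul_left (b^2)) (hasSum_T e β T hT x)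
  by_cases h0 : e.repr x n = 0
  · simp [h0]
  · have := h n h0
    gcongr

lemma upper_T (e : HilbertBasis ℤ ℂ H) (β : ℤ → ℂ) (T : H →L[ℂ] H)
    (hT : ∀ n : ℤ, T (e n) = β n • e (n + 1)) (x : H) (b : ℝ) (hb : 0 ≤ b)
    (h : ∀ n, e.repr x n ≠ 0 → ‖β n‖ ≤ b) : ‖T x‖ ≤ b * ‖x‖ := by
  apply le_of_sq_le_sq _ (by positivity)
  rw [mul_pow]
  refine hasSum_le (fun n => ?_) (hasSum_T e β T hT x) ((hasSum_coord e x).mul_left (b^2))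
  by_cases h0 : e.repr x n = 0
  · simp [h0]
  · have := h n h0
    gcongr

lemma exists_proj (e : HilbertBasis ℤ ℂ H) (S : Set ℤ) [DecidablePred (· ∈ S)] :
    ∃ P : H →L[ℂ] H, ∀ x n, e.repr (P x) n = if n ∈ S then e.repr x n else 0 := by
  let K : Submodule ℂ H := (Submodule.span ℂ (e '' S)).topologicalClosure
  have hP : ∀ k, K.starProjection (e k) = if k ∈ S then e k else 0 := by
    intro k
    split_ifs with hk
    · rw [Submodule.starProjection_eq_self_iff]
      exact Submodule.le_topologicalClosure _ (Submodule.subset_span ⟨k, hk, rfl⟩)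
    · rw [Submodule.starProjection_apply_eq_zero_iff]
      rw [Submodule.orthogonal_closure]
      rw [Submodule.mem_orthogonal]
      intro u hu
      induction hu using Submodule.span_induction with
      | mem x hx =>
        obtain ⟨j, hj, rfl⟩ := hx
        exact e.orthonormal.2 (fun h => hk (h ▸ hj))
      | zero => simp
      | add x y _ _ hx hy => simp [inner_add_left, hx, hy]
      | smul a x _ hx => simp [inner_smul_left, hx]
  refine ⟨K.starProjection, fun x n => ?_⟩
  have : (innerSL ℂ (e n)).comp K.starProjection =
      (if n ∈ S then (1:ℂ) else 0) • innerSL ℂ (e n) := by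
    apply clm_ext e
    intro k
    have h2 := orthonormal_iff_ite.mp e.orthonormal n k
    simp only [ContinuousLinearMap.comp_apply, hP, innerSL_apply_apply,
      ContinuousLinearMap.smul_apply, h2, smul_eq_mul]
    by_cases h : n = k
    · subst h
      rw [if_pos rfl] at h2
      by_cases hS : n ∈ S
      · rw [if_pos hS, if_pos hS, h2]; simp
      · simp [hS]
    · rw [if_neg h] at h2
      by_cases hS : k ∈ S
      · rw [if_pos hS, h2]; simp [h]
      · simp [hS, h]
  have := congrArg (fun f => f x) this
  rw [e.repr_apply_apply, e.repr_apply_apply]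
  by_cases hS : n ∈ S
  · simpa [hS] using this
  · simpa [hS] using this

lemma norm_le_of_coord (e : HilbertBasis ℤ ℂ H) {x y : H}
    (h : ∀ n, ‖e.repr x n‖ ≤ ‖e.repr y n‖) : ‖x‖ ≤ ‖y‖ := by
  apply le_of_sq_le_sq _ (norm_nonneg _)
  refine hasSum_le (fun n => ?_) (hasSum_coord e x) (hasSum_coord e y)
  have := h n
  gcongr

/-- Bounded below in the open annulus. -/
lemma bddBelow_annulus (e : HilbertBasis ℤ ℂ H) (β : ℤ → ℂ) (T : H →L[ℂ] H)
    (hT : ∀ n : ℤ, T (e n) = β n • e (n + 1)) (hmono : Monotone fun n => ‖β n‖)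
    (hnz : ∀ n : ℤ, β n ≠ 0) (lam : ℂ) (p q : ℤ) (hp : ‖lam‖ < ‖β p‖) (hq : ‖β q‖ < ‖lam‖) :
    ∃ c : ℝ, 0 < c ∧ ∀ x : H, c * ‖x‖ ≤ ‖(lam • (1 : H →L[ℂ] H) - T) x‖ := by
  classical
  choose P hP using fun N : ℤ => exists_proj e (Set.Ici N)
  choose Q hQ using fun N : ℤ => exists_proj e (Set.Iio N)
  set A := lam • (1 : H →L[ℂ] H) - T with hA
  have hPT : ∀ N x, P (N+1) (T x) = T (P N x) := by
    intro N x
    apply ext_coord e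
    intro n
    obtain ⟨n, rfl⟩ : ∃ k, n = k + 1 := ⟨n-1, by ring⟩
    simp [hP, coord_T e β T hT]
  have hQT : ∀ N x, Q (N+1) (T x) = T (Q N x) := by
    intro N x
    apply ext_coord e
    intro n
    obtain ⟨n, rfl⟩ : ∃ k, n = k + 1 := ⟨n-1, by ring⟩
    simp [hQ, coord_T e β T hT]
  have hPn : ∀ N x, ‖P N x‖ ≤ ‖x‖ := fun N x => norm_le_of_coord e fun n => by
    rw [hP]; split_ifs <;> simp
  have hQn : ∀ N x, ‖Q N x‖ ≤ ‖x‖ := fun N x => norm_le_of_coord e fun n => by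
    rw [hQ]; split_ifs <;> simp
  have hPs : ∀ N x, ‖P (N+1) x‖ ≤ ‖P N x‖ := fun N x => norm_le_of_coord e fun n => by
    simp only [hP, Set.mem_Ici]; split_ifs <;> first | omega | simp
  have hQs : ∀ N x, ‖Q N x‖ ≤ ‖Q (N+1) x‖ := fun N x => norm_le_of_coord e fun n => by
    simp only [hQ, Set.mem_Iio]; split_ifs <;> first | omega | simp
  have hPQ : ∀ N x, x = P N x + Q N x := by
    intro N x
    apply ext_coord e
    intro n
    simp only [map_add, lp.coeFn_add, Pi.add_apply, hP, hQ, Set.mem_Ici, Set.mem_Iio]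
    split_ifs <;> first | omega | simp
  have hTP : ∀ N x, ‖β N‖ * ‖P N x‖ ≤ ‖T (P N x)‖ := fun N x =>
    lower_T e β T hT _ _ (norm_nonneg _) fun n hn => by
      rw [hP] at hn
      by_cases h : n ∈ Set.Ici N
      · exact hmono h
      · simp [h] at hn
  have hTQ : ∀ N x, ‖T (Q N x)‖ ≤ ‖β N‖ * ‖Q N x‖ := fun N x =>
    upper_T e β T hT _ _ (norm_nonneg _) fun n hn => by
      rw [hQ] at hn
      by_cases h : n ∈ Set.Iio N
      · exact hmono (le_of_lt h)
      · simp [h] at hn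
  have hAP : ∀ N x, T (P N x) = lam • P (N+1) x - P (N+1) (A x) := by
    intro N x; simp [hA, hPT]
  have hAQ : ∀ N x, lam • Q (N+1) x = T (Q N x) + Q (N+1) (A x) := by
    intro N x; simp [hA, hQT]
  have hPest : ∀ N x, ‖β N‖ * ‖P N x‖ ≤ ‖lam‖ * ‖P (N+1) x‖ + ‖A x‖ := by
    intro N x
    refine (hTP N x).trans ?_
    rw [hAP]
    refine (norm_sub_le _ _).trans ?_
    rw [norm_smul]
    linarith [hPn (N+1) (A x)]
  have hQest : ∀ N x, ‖lam‖ * ‖Q (N+1) x‖ ≤ ‖β N‖ * ‖Q N x‖ + ‖A x‖ := by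
    intro N x
    rw [← norm_smul, hAQ]
    refine (norm_add_le _ _).trans ?_
    linarith [hQn (N+1) (A x), hTQ N x]
  have key : ∀ k : ℕ, ∃ C : ℝ, 0 < C ∧ ∀ x, ‖P (p - k) x‖ ≤ C * ‖A x‖ := by
    intro k
    induction k with
    | zero =>
      have h0 : 0 < ‖β p‖ - ‖lam‖ := by linarith
      refine ⟨(‖β p‖ - ‖lam‖)⁻¹, by positivity, fun x => ?_⟩
      rw [inv_mul_eq_div, le_div_iff₀ h0]
      have h1 := hPest p x
      have h2 := mul_le_mul_of_nonneg_left (hPs p x) (norm_nonneg lam)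
      simp only [Nat.cast_zero, sub_zero]
      nlinarith
    | succ k ih =>
      obtain ⟨C, hC, ih⟩ := ih
      have h0 : 0 < ‖β (p - (k+1:ℕ))‖ := norm_pos_iff.mpr (hnz _)
      refine ⟨(‖lam‖ * C + 1) / ‖β (p - (k+1:ℕ))‖, by positivity, fun x => ?_⟩
      rw [div_mul_eq_mul_div, le_div_iff₀ h0]
      have h1 := hPest (p - (k+1:ℕ)) x
      have h3 : p - ((k+1:ℕ):ℤ) + 1 = p - k := by push_cast; ring
      rw [h3] at h1
      have h2 := mul_le_mul_of_nonneg_left (ih x) (norm_nonneg lam)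
      nlinarith
  have hqp : q < p := by
    by_contra h
    have := hmono (not_lt.mp h)
    simp only at this
    linarith
  obtain ⟨C, hC, hk⟩ := key (p - (q+1)).toNat
  rw [Int.toNat_of_nonneg (by omega)] at hk
  have hd : 0 < ‖lam‖ - ‖β q‖ := by linarith
  have hqq : ∀ x, ‖Q (q+1) x‖ ≤ (‖lam‖ - ‖β q‖)⁻¹ * ‖A x‖ := by
    intro x
    rw [inv_mul_eq_div, le_div_iff₀ hd]
    have h1 := hQest q x
    have h2 := mul_le_mul_of_nonneg_left (hQs q x) (norm_nonneg (β q))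
    nlinarith
  refine ⟨(C + (‖lam‖ - ‖β q‖)⁻¹)⁻¹, by positivity, fun x => ?_⟩
  rw [inv_mul_le_iff₀ (by positivity)]
  have h1 := hk x
  rw [show p - (p - (q+1)) = q+1 by ring] at h1
  calc ‖x‖ = ‖P (q+1) x + Q (q+1) x‖ := by rw [← hPQ]
    _ ≤ _ := norm_add_le _ _
    _ ≤ _ := by linarith [hqq x]

lemma tail_zero_top (a : ℤ → ℝ) (ha : ∀ n, 0 ≤ a n) (h0 : Tendsto a atTop (𝓝 0)) (N : ℤ)
    (h : ∀ n, N ≤ n → a n ≤ a (n+1)) (n : ℤ) (hn : N ≤ n) : a n = 0 := by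
  apply le_antisymm _ (ha n)
  refine ge_of_tendsto h0 ?_
  filter_upwards [eventually_ge_atTop n] with k hk
  induction k, hk using Int.leInduction with
  | base => exact le_rfl
  | succ k hk ih => exact ih.trans (h k (hn.trans hk))

lemma tail_zero_bot (a : ℤ → ℝ) (ha : ∀ n, 0 ≤ a n) (h0 : Tendsto a atBot (𝓝 0)) (N : ℤ)
    (h : ∀ n, n < N → a (n+1) ≤ a n) (n : ℤ) (hn : n ≤ N) : a n = 0 := by
  have := tail_zero_top (fun k => a (-k)) (fun k => ha _) (h0.comp tendsto_neg_atTop_atBot) (-N)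
    (fun k hk => by
      have := h (-(k+1)) (by omega)
      rwa [show -(k+1)+1 = -k by ring] at this) (-n) (by omega)
  simpa using this

/-- Non-surjectivity. -/
lemma not_in_range (e : HilbertBasis ℤ ℂ H) (β : ℤ → ℂ) (T : H →L[ℂ] H)
    (hT : ∀ n : ℤ, T (e n) = β n • e (n + 1))
    (hnz : ∀ n : ℤ, β n ≠ 0) (lam : ℂ) (hlam : lam ≠ 0) (p q : ℤ)
    (hp : ∀ n, p ≤ n → ‖lam‖ ≤ ‖β n‖) (hq : ∀ n, n < q → ‖β n‖ ≤ ‖lam‖) (x : H)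
    (hx : (lam • (1 : H →L[ℂ] H) - T) x = e 0) : False := by
  have hc : ∀ n, lam * e.repr x (n+1) - β n * e.repr x n = if n + 1 = 0 then 1 else 0 := by
    intro n
    rw [← repr_basis e, ← hx, ← coord_T e β T hT]
    simp
    rfl
  have hc' : ∀ n, n ≠ -1 → lam * e.repr x (n+1) = β n * e.repr x n := by
    intro n hn
    have := hc n
    rw [if_neg (by omega)] at this
    exact sub_eq_zero.mp this
  have hcn : ∀ n, n ≠ -1 → ‖lam‖ * ‖e.repr x (n+1)‖ = ‖β n‖ * ‖e.repr x n‖ := by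
    intro n hn
    rw [← norm_mul, ← norm_mul, hc' n hn]
  have hl : 0 < ‖lam‖ := norm_pos_iff.mpr hlam
  have h1 : ∀ n, max p 0 ≤ n → e.repr x n = 0 := by
    intro n hn
    rw [← norm_eq_zero]
    refine tail_zero_top _ (fun n => norm_nonneg _) (tendsto_coord_top e x) (max p 0) ?_ n hn
    intro k hk
    have h1 := hcn k (by omega)
    have h2 := mul_le_mul_of_nonneg_right (hp k (by omega)) (norm_nonneg (e.repr x k))
    rw [← h1] at h2
    exact le_of_mul_le_mul_left h2 hl
  have h2 : ∀ n, n ≤ min q (-1) → e.repr x n = 0 := by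
    intro n hn
    rw [← norm_eq_zero]
    refine tail_zero_bot _ (fun n => norm_nonneg _) (tendsto_coord_bot e x) (min q (-1)) ?_ n hn
    intro k hk
    have h1 := hcn k (by omega)
    have h2 := mul_le_mul_of_nonneg_right (hq k (by omega)) (norm_nonneg (e.repr x k))
    rw [← h1] at h2
    exact le_of_mul_le_mul_left h2 hl
  have h3 : ∀ k : ℕ, (k:ℤ) ≤ max p 0 → e.repr x (max p 0 - k) = 0 := by
    intro k
    induction k with
    | zero => intro _; exact h1 _ (by simp)
    | succ k ih =>
      intro hk
      have h5 := ih (by push_cast at hk; omega)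
      have h4 := hc' (max p 0 - (k+1:ℕ)) (by omega)
      rw [show max p 0 - ((k+1:ℕ):ℤ) + 1 = max p 0 - k by push_cast; ring, h5, mul_zero] at h4
      exact (mul_eq_zero.mp h4.symm).resolve_left (hnz _)
  have h4 : ∀ k : ℕ, min q (-1) + k ≤ -1 → e.repr x (min q (-1) + k) = 0 := by
    intro k
    induction k with
    | zero => intro _; exact h2 _ (by simp)
    | succ k ih =>
      intro hk
      have h5 := ih (by push_cast at hk; omega)
      have h4 := hc' (min q (-1) + k) (by push_cast at hk; omega)
      rw [h5, mul_zero] at h4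
      have := (mul_eq_zero.mp h4).resolve_left hlam
      rwa [show min q (-1) + ((k + 1 : ℕ) : ℤ) = min q (-1) + k + 1 by push_cast; ring]
  have h5 := h3 (max p 0).toNat (by omega)
  have h6 := h4 (-1 - min q (-1)).toNat (by omega)
  rw [show max p 0 - ((max p 0).toNat : ℤ) = 0 by omega] at h5
  rw [show min q (-1) + ((-1 - min q (-1)).toNat : ℤ) = -1 by omega] at h6
  have := hc (-1)
  simp [h5, h6] at this

lemma isUnit_of (A : H →L[ℂ] H) (hd : DenseRange A)
    (hb : ∃ c : ℝ, 0 < c ∧ ∀ x : H, c * ‖x‖ ≤ ‖A x‖) : IsUnit A := by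
  obtain ⟨c, hc, hb⟩ := hb
  have ha : AntilipschitzWith (Real.toNNReal c⁻¹) A := by
    apply AddMonoidHomClass.antilipschitz_of_bound
    intro x
    rw [Real.coe_toNNReal _ (by positivity), inv_mul_eq_div, le_div_iff₀ hc]
    linarith [hb x]
  have hcl : IsClosed (Set.range A) := ha.isClosed_range A.uniformContinuous
  rw [ContinuousLinearMap.isUnit_iff_bijective]
  refine ⟨ha.injective, ?_⟩
  rw [← Set.range_eq_univ, ← hcl.closure_eq]
  exact hd.closure_range

lemma dense_of (e : HilbertBasis ℤ ℂ H) (β : ℤ → ℂ) (T : H →L[ℂ] H)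
    (hT : ∀ n : ℤ, T (e n) = β n • e (n + 1)) (hnz : ∀ n : ℤ, β n ≠ 0) (lam : ℂ)
    (h : (∀ n, ‖lam‖ ≤ ‖β n‖) ∨ (∀ n, ‖β n‖ ≤ ‖lam‖)) :
    DenseRange ⇑(lam • (1 : H →L[ℂ] H) - T) := by
  set A := lam • (1 : H →L[ℂ] H) - T with hA
  have hr : (LinearMap.range A.toLinearMap)ᗮ = ⊥ := by
    rw [eq_bot_iff]
    intro z hz
    rw [Submodule.mem_orthogonal'] at hz
    have h1 : ∀ n, ‖lam‖ * ‖e.repr z n‖ = ‖β n‖ * ‖e.repr z (n+1)‖ := by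
      intro n
      have := hz (A (e n)) ⟨e n, rfl⟩
      simp only [hA, ContinuousLinearMap.sub_apply, ContinuousLinearMap.smul_apply,
        ContinuousLinearMap.one_apply, hT, inner_sub_right, inner_smul_right] at this
      have := congrArg norm (sub_eq_zero.mp this)
      rw [norm_mul, norm_mul, norm_inner_symm, norm_inner_symm z] at this
      simpa [e.repr_apply_apply] using this
    have : z = 0 := by
      apply ext_coord e
      intro n
      simp only [map_zero, lp.coeFn_zero, Pi.zero_apply]
      rw [← norm_eq_zero]
      rcases h with h | h
      · refine tail_zero_bot _ (fun n => norm_nonneg _) (tendsto_coord_bot e z) n ?_ n le_rfl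
        intro k _
        have h2 := mul_le_mul_of_nonneg_right (h k) (norm_nonneg (e.repr z k))
        rw [h1] at h2
        exact le_of_mul_le_mul_left h2 (norm_pos_iff.mpr (hnz k))
      · refine tail_zero_top _ (fun n => norm_nonneg _) (tendsto_coord_top e z) n ?_ n le_rfl
        intro k _
        have h2 := mul_le_mul_of_nonneg_right (h k) (norm_nonneg (e.repr z (k+1)))
        rw [← h1] at h2
        exact le_of_mul_le_mul_left h2 ((norm_pos_iff.mpr (hnz k)).trans_le (h k))
    simpa using this
  rw [← Submodule.topologicalClosure_eq_top_iff, ← Submodule.dense_iff_topologicalClosure_eq_top]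
    at hr
  exact hr

end

end WShift

open WShift in
/-- For a hyponormal bilateral weighted shift with nonzero weights, the
compression spectrum is exactly the open annulus `{λ : m < ‖λ‖ < M}` and the
approximate point spectrum is `{λ : ‖λ‖ = m ∨ ‖λ‖ = M}`. -/
theorem compression_and_approxPoint_spectrum_of_hyponormal_bilateral_weighted_shift
    {H : Type*} [NormedAddCommGroup H] [InnerProductSpace ℂ H] [CompleteSpace H]
    (e : HilbertBasis ℤ ℂ H) (β : ℤ → ℂ) (T : H →L[ℂ] H)
    (hT : ∀ n : ℤ, T (e n) = β n • e (n + 1))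
    (hmono : ∀ n : ℤ, ‖β n‖ ≤ ‖β (n + 1)‖)
    (hnz : ∀ n : ℤ, β n ≠ 0)
    (M : ℝ) (hM : Filter.Tendsto (fun n : ℤ => ‖β n‖) Filter.atTop (nhds M))
    (m : ℝ) (hm : Filter.Tendsto (fun n : ℤ => ‖β n‖) Filter.atBot (nhds m)) :
    {lam : ℂ | ¬ DenseRange ⇑(lam • (1 : H →L[ℂ] H) - T)}
        = {lam : ℂ | m < ‖lam‖ ∧ ‖lam‖ < M} ∧
      {lam : ℂ | ¬ ∃ c : ℝ, 0 < c ∧ ∀ x : H,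
          c * ‖x‖ ≤ ‖(lam • (1 : H →L[ℂ] H) - T) x‖}
        = {lam : ℂ | ‖lam‖ = m ∨ ‖lam‖ = M} := by
  have hmon : Monotone fun n => ‖β n‖ := monotone_int_of_le_succ hmono
  have hleM : ∀ n, ‖β n‖ ≤ M := fun n => hmon.ge_of_tendsto hM n
  have hlem : ∀ n, m ≤ ‖β n‖ := fun n => hmon.le_of_tendsto hm n
  have hm0 : 0 ≤ m := ge_of_tendsto hm (Eventually.of_forall fun n => norm_nonneg _)
  have hM0 : 0 < M := (norm_pos_iff.mpr (hnz 0)).trans_le (hleM 0)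
  have hmM : m ≤ M := (hlem 0).trans (hleM 0)
  have hbA : ∀ lam : ℂ, m < ‖lam‖ → ‖lam‖ < M → ∃ c : ℝ, 0 < c ∧ ∀ x : H,
      c * ‖x‖ ≤ ‖(lam • (1 : H →L[ℂ] H) - T) x‖ := by
    intro lam h1 h2
    obtain ⟨p, hp⟩ := (hM.eventually_const_lt h2).exists
    obtain ⟨q, hq⟩ := (hm.eventually_lt_const h1).exists
    exact bddBelow_annulus e β T hT hmon hnz lam p q hp hq
  have hnsurj : ∀ lam : ℂ, m < ‖lam‖ → ‖lam‖ < M → ¬ IsUnit (lam • (1 : H →L[ℂ] H) - T) := by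
    intro lam h1 h2 hu
    obtain ⟨p, hp⟩ := (hM.eventually_const_lt h2).exists
    obtain ⟨q, hq⟩ := (hm.eventually_lt_const h1).exists
    obtain ⟨x, hx⟩ := ((ContinuousLinearMap.isUnit_iff_bijective).mp hu).2 (e 0)
    exact not_in_range e β T hT hnz lam (norm_pos_iff.mp (hm0.trans_lt h1)) p q
      (fun n hn => hp.le.trans (hmon hn)) (fun n hn => (hmon hn.le).trans hq.le) x hx
  have hdense : ∀ lam : ℂ, ¬ (m < ‖lam‖ ∧ ‖lam‖ < M) →
      DenseRange ⇑(lam • (1 : H →L[ℂ] H) - T) := by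
    intro lam h
    apply dense_of e β T hT hnz
    by_cases h1 : m < ‖lam‖
    · right
      intro n
      exact (hleM n).trans (not_lt.mp fun h2 => h ⟨h1, h2⟩)
    · left
      intro n
      exact (not_lt.mp h1).trans (hlem n)
  constructor
  · ext lam
    simp only [Set.mem_setOf_eq]
    constructor
    · intro h
      by_contra h'
      exact h (hdense lam h')
    · rintro ⟨h1, h2⟩ hd
      exact hnsurj lam h1 h2 (isUnit_of _ hd (hbA lam h1 h2))
  · ext lam
    simp only [Set.mem_setOf_eq]
    constructor
    · intro h
      by_contra hne
      push Not at hne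
      apply h
      rcases lt_or_gt_of_ne hne.1 with h1 | h1
      · refine ⟨m - ‖lam‖, by linarith, fun x => ?_⟩
        have h2 := lower_T e β T hT x m hm0 (fun n _ => hlem n)
        have h3 := norm_sub_norm_le (T x) (lam • x)
        rw [norm_sub_rev, norm_smul] at h3
        simp only [ContinuousLinearMap.sub_apply, ContinuousLinearMap.smul_apply,
          ContinuousLinearMap.one_apply]
        linarith
      · rcases lt_or_gt_of_ne hne.2 with h4 | h4
        · exact hbA lam h1 h4
        · refine ⟨‖lam‖ - M, by linarith, fun x => ?_⟩
          have h2 := upper_T e β T hT x M hM0.le (fun n _ => hleM n)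
          have h3 := norm_sub_norm_le (lam • x) (T x)
          rw [norm_smul] at h3
          simp only [ContinuousLinearMap.sub_apply, ContinuousLinearMap.smul_apply,
            ContinuousLinearMap.one_apply]
          linarith
    · intro h hb
      have hu : IsUnit (lam • (1 : H →L[ℂ] H) - T) := isUnit_of _ (hdense lam (by
        rintro ⟨h1, h2⟩
        rcases h with h | h <;> linarith)) hb
      rcases hmM.eq_or_lt with heq | hlt
      · have hl : ‖lam‖ = M := by rcases h with h | h <;> linarith
        obtain ⟨x, hx⟩ := ((ContinuousLinearMap.isUnit_iff_bijective).mp hu).2 (e 0)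
        refine not_in_range e β T hT hnz lam (norm_pos_iff.mp (by linarith)) 0 0
          (fun n hn => ?_) (fun n hn => ?_) x hx
        · linarith [hlem n]
        · linarith [hleM n]
      · obtain ⟨u, hu1, hlu⟩ : ∃ u : ℂ, ‖u‖ = 1 ∧ lam = (‖lam‖ : ℂ) * u := by
          by_cases h0 : lam = 0
          · exact ⟨1, by simp, by simp [h0]⟩
          · have h0' : (‖lam‖ : ℂ) ≠ 0 := by simpa using h0
            refine ⟨lam / ‖lam‖, ?_, ?_⟩
            · simp [h0]
            · field_simp
        have hcont : Continuous fun s : ℝ => (((s : ℂ) * u) • (1 : H →L[ℂ] H) - T) := by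
          fun_prop
        have hev : ∀ᶠ s : ℝ in 𝓝 ‖lam‖, IsUnit (((s : ℂ) * u) • (1 : H →L[ℂ] H) - T) := by
          have hopen : IsOpen {A : H →L[ℂ] H | IsUnit A} := Units.isOpen
          refine (hopen.preimage hcont).mem_nhds ?_
          simp only [Set.mem_preimage, Set.mem_setOf_eq]
          rwa [← hlu]
        have hcon : ∀ s : ℝ, s ∈ Set.Ioo m M →
            ¬ IsUnit (((s : ℂ) * u) • (1 : H →L[ℂ] H) - T) := by
          intro s hs
          have hn : ‖(s : ℂ) * u‖ = s := by
            rw [norm_mul, hu1, mul_one, Complex.norm_real, Real.norm_of_nonneg]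
            linarith [hs.1]
          exact hnsurj _ (by rw [hn]; exact hs.1) (by rw [hn]; exact hs.2)
        rcases h with h | h
        · rw [h] at hev
          obtain ⟨s, hs1, hs2⟩ := ((hev.filter_mono (nhdsWithin_le_nhds (s := Set.Ioi m))).and
            (Ioo_mem_nhdsGT hlt)).exists
          exact hcon s hs2 hs1
        · rw [h] at hev
          obtain ⟨s, hs1, hs2⟩ := ((hev.filter_mono (nhdsWithin_le_nhds (s := Set.Iio M))).and
            (Ioo_mem_nhdsLT hlt)).exists
          exact hcon s hs2 hs1
end

section
/- For all real numbers r, R with 0 ≤ r ≤ R there exists a hyponormal bilateral weighted shift T on H whose spectrum is exactly the closed annulus {λ ∈ ℂ : r ≤ |λ| ≤ R}; moreover, for every closed annulus A = {λ ∈ ℂ : r ≤ |λ − β| ≤ R} in the complex plane there exists a hyponormal operator of the form T + βI, with T a hyponormal bilateral weighted shift and β ∈ ℂ, whose spectrum is exactly A. -/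
section Aux

open ContinuousLinearMap

variable {H : Type*} [NormedAddCommGroup H] [InnerProductSpace ℂ H] [CompleteSpace H]

theorem aux_sq (e : HilbertBasis ℤ ℂ H) (x : H) :
    HasSum (fun n => ‖e.repr x n‖ ^ 2) (‖x‖ ^ 2) := by
  have h := lp.hasSum_norm (p := 2) (by norm_num) (e.repr x)
  simpa using h

theorem aux_diag (e : HilbertBasis ℤ ℂ H) (d : ℤ → ℂ) (M : ℝ) (hd : ∀ n, ‖d n‖ ≤ M) :
    ∃ D : H →L[ℂ] H, (∀ x n, e.repr (D x) n = d n * e.repr x n) ∧ ‖D‖ ≤ M := by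
  have hM : 0 ≤ M := (norm_nonneg _).trans (hd 0)
  have hs : ∀ x : H, ∀ n, ‖d n * e.repr x n‖ ^ 2 ≤ M ^ 2 * ‖e.repr x n‖ ^ 2 := by
    intro x n
    rw [norm_mul, mul_pow]
    have := hd n
    gcongr
  have hm : ∀ x : H, Memℓp (fun n => d n * e.repr x n) 2 := by
    intro x
    apply memℓp_gen
    have := Summable.of_nonneg_of_le (fun n => by positivity) (hs x)
      ((aux_sq e x).summable.mul_left (M ^ 2))
    simpa using this
  let L : H →ₗ[ℂ] H :=
    { toFun := fun x => e.repr.symm ⟨fun n => d n * e.repr x n, hm x⟩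
      map_add' := by
        intro x y
        rw [← map_add]
        congr 1
        ext n
        simp [mul_add]
        rfl
      map_smul' := by
        intro c x
        rw [RingHom.id_apply, ← map_smul]
        congr 1
        ext n
        simp
        ring }
  have hL : ∀ x n, e.repr (L x) n = d n * e.repr x n := by
    intro x n
    change e.repr (e.repr.symm _) n = _
    rw [LinearIsometryEquiv.apply_symm_apply]
  have hb : ∀ x, ‖L x‖ ≤ M * ‖x‖ := by
    intro x
    have h2 : ‖L x‖ ^ 2 ≤ (M * ‖x‖) ^ 2 := by
      rw [mul_pow]
      refine hasSum_le (fun n => ?_) (aux_sq e (L x)) ((aux_sq e x).mul_left (M ^ 2))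
      rw [hL]
      exact hs x n
    exact le_of_sq_le_sq h2 (by positivity)
  exact ⟨L.mkContinuous M hb, hL, L.mkContinuous_norm_le hM hb⟩

theorem aux_shift (e : HilbertBasis ℤ ℂ H) :
    ∃ S : H ≃ₗᵢ[ℂ] H, (∀ n, S (e n) = e (n + 1)) := by
  have ho : Orthonormal ℂ (fun n : ℤ => e (n + 1)) :=
    e.orthonormal.comp _ (add_left_injective 1)
  have hr : Set.range (fun n : ℤ => e (n + 1)) = Set.range e := by
    ext y
    constructor
    · rintro ⟨n, rfl⟩
      exact ⟨n + 1, rfl⟩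
    · rintro ⟨n, rfl⟩
      exact ⟨n - 1, by simp⟩
  let e' := HilbertBasis.mk ho (by rw [hr, e.dense_span])
  refine ⟨e.repr.trans e'.repr.symm, fun n => ?_⟩
  have : e' n = e (n + 1) := by simp [e']
  rw [LinearIsometryEquiv.trans_apply, e.repr_self, ← e'.repr_self, e'.repr.symm_apply_apply, this]

theorem aux_hypo (T : H →L[ℂ] H) (b : ℂ) (h : ∀ x, ‖adjoint T x‖ ≤ ‖T x‖) (x : H) :
    ‖adjoint (T + b • (1 : H →L[ℂ] H)) x‖ ≤ ‖(T + b • (1 : H →L[ℂ] H)) x‖ := by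
  have h1 : adjoint (T + b • (1 : H →L[ℂ] H)) x = adjoint T x + (starRingEnd ℂ) b • x := by
    have : adjoint (1 : H →L[ℂ] H) = 1 := by
      rw [← star_eq_adjoint]; simp
    rw [map_add, map_smulₛₗ, this]
    rfl
  have h2 : (T + b • (1 : H →L[ℂ] H)) x = T x + b • x := by simp
  rw [h1, h2]
  refine le_of_sq_le_sq ?_ (norm_nonneg _)
  rw [@norm_add_sq ℂ, @norm_add_sq ℂ]
  have h3 : RCLike.re (inner ℂ (adjoint T x) ((starRingEnd ℂ) b • x))
      = RCLike.re (inner ℂ (T x) (b • x)) := by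
    rw [inner_smul_right, inner_smul_right, adjoint_inner_left, ← inner_conj_symm x (T x),
      ← map_mul, RCLike.conj_re]
  rw [h3]
  have := pow_le_pow_left₀ (norm_nonneg _) (h x) 2
  simp only [norm_smul, RCLike.norm_conj]
  linarith

theorem aux_main (e : HilbertBasis ℤ ℂ H) (r R : ℝ) (hr : 0 ≤ r) (hR : r ≤ R) :
    ∃ (T : H →L[ℂ] H) (β : ℤ → ℂ),
      (∀ n : ℤ, T (e n) = β n • e (n + 1)) ∧
      (∀ n : ℤ, ‖β n‖ ≤ ‖β (n + 1)‖) ∧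
      (∀ x, ‖adjoint T x‖ ≤ ‖T x‖) ∧
      spectrum ℂ T = {lam : ℂ | r ≤ ‖lam‖ ∧ ‖lam‖ ≤ R} := by
  have hR0 : 0 ≤ R := hr.trans hR
  let β : ℤ → ℂ := fun n => if n < 0 then (r : ℂ) else (R : ℂ)
  have hβneg : ∀ n : ℤ, n < 0 → β n = r := fun n hn => by simp [β, hn]
  have hβpos : ∀ n : ℤ, 0 ≤ n → β n = R := fun n hn => by simp [β, not_lt.2 hn]
  have hβr : ∀ n, r ≤ ‖β n‖ := by
    intro n
    rcases lt_or_ge n 0 with h | h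
    · rw [hβneg n h]; simp [abs_of_nonneg hr]
    · rw [hβpos n h]; simpa [abs_of_nonneg hR0] using hR
  have hβR : ∀ n, ‖β n‖ ≤ R := by
    intro n
    rcases lt_or_ge n 0 with h | h
    · rw [hβneg n h]; simpa [abs_of_nonneg hr] using hR
    · rw [hβpos n h]; simp [abs_of_nonneg hR0]
  have hmono : ∀ n : ℤ, ‖β n‖ ≤ ‖β (n + 1)‖ := by
    intro n
    rcases lt_or_ge n 0 with h | h
    · rw [hβneg n h]; simpa [abs_of_nonneg hr] using hβr (n + 1)
    · rw [hβpos n h, hβpos _ (by omega)]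
  obtain ⟨D, hD, hDn⟩ := aux_diag e β R hβR
  obtain ⟨S, hS⟩ := aux_shift e
  let T : H →L[ℂ] H := (S : H →L[ℂ] H) ∘L D
  have hTx : ∀ x, T x = S (D x) := fun x => rfl
  have hTe : ∀ n : ℤ, T (e n) = β n • e (n + 1) := by
    intro n
    have : D (e n) = β n • e n := by
      apply e.repr.injective
      ext m
      rw [hD, map_smul]
      by_cases hmn : m = n
      · subst hmn; simp
      · rw [e.repr_self]
        simp [lp.single_apply, hmn, Pi.single_apply]
    rw [hTx, this, map_smul, hS]
  have hTc : ∀ x n, e.repr (T x) (n + 1) = β n * e.repr x n := by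
    intro x n
    rw [hTx, ← hD, e.repr_apply_apply, e.repr_apply_apply, ← hS, S.inner_map_map]
  have hTa : ∀ x n, e.repr (adjoint T x) n = (starRingEnd ℂ) (β n) * e.repr x (n + 1) := by
    intro x n
    rw [e.repr_apply_apply, e.repr_apply_apply, adjoint_inner_right, hTe, inner_smul_left]
  have hTnorm : ‖T‖ ≤ R := by
    refine T.opNorm_le_bound hR0 fun x => ?_
    rw [hTx, S.norm_map]
    exact D.le_of_opNorm_le hDn x
  refine ⟨T, β, hTe, hmono, ?_, ?_⟩
  · intro x
    refine le_of_sq_le_sq ?_ (norm_nonneg _)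
    have h1 := (Equiv.addRight (1 : ℤ)).hasSum_iff.2 (aux_sq e (adjoint T x))
    have h2 := (Equiv.addRight (1 : ℤ)).hasSum_iff.2 (aux_sq e (T x))
    have h2 := (Equiv.addRight (1 : ℤ)).hasSum_iff.2 h2
    refine hasSum_le (fun n => ?_) (aux_sq e (adjoint T x)) h2
    simp only [Function.comp, Equiv.coe_addRight]
    rw [hTa, hTc, norm_mul, norm_mul, RCLike.norm_conj]
    have := hmono n
    gcongr
  · have : Nontrivial H := ⟨e 0, 0, e.orthonormal.ne_zero 0⟩
    ext lam
    constructor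
    · intro hl
      refine ⟨?_, (spectrum.norm_le_norm_of_mem hl).trans hTnorm⟩
      rcases hr.eq_or_lt with h0 | h0
      · rw [← h0]; exact norm_nonneg _
      have hβ0 : ∀ n, β n ≠ 0 := fun n h => by
        have := hβr n
        rw [h, norm_zero] at this
        linarith
      obtain ⟨D', hD', hDn'⟩ := aux_diag e (fun n => (β n)⁻¹) r⁻¹ (fun n => by
        rw [norm_inv]
        exact inv_anti₀ h0 (hβr n))
      have hDD : ∀ x, D (D' x) = x := by
        intro x
        apply e.repr.injective
        ext n
        rw [hD, hD', mul_inv_cancel_left₀ (hβ0 n)]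
      have hDD' : ∀ x, D' (D x) = x := by
        intro x
        apply e.repr.injective
        ext n
        rw [hD', hD, inv_mul_cancel_left₀ (hβ0 n)]
      let V : H →L[ℂ] H := D' ∘L (S.symm : H →L[ℂ] H)
      have hVx : ∀ x, V x = D' (S.symm x) := fun x => rfl
      let u : (H →L[ℂ] H)ˣ := ⟨T, V, by
        ext x
        change T (V x) = x
        rw [hVx, hTx, hDD, S.apply_symm_apply], by
        ext x
        change V (T x) = x
        rw [hVx, hTx, S.symm_apply_apply, hDD']⟩
      have hVn : ‖V‖ ≤ r⁻¹ := by
        refine V.opNorm_le_bound (by positivity) fun x => ?_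
        rw [hVx, ← S.symm.norm_map x]
        exact D'.le_of_opNorm_le hDn' _
      have hl0 : lam ≠ 0 := by
        rintro rfl
        exact spectrum.zero_notMem ℂ u.isUnit hl
      have := spectrum.inv_mem_iff (r := Units.mk0 lam hl0) (a := u)
      have h3 := spectrum.norm_le_norm_of_mem (this.1 hl)
      have h4 : ‖lam⁻¹‖ ≤ r⁻¹ := by
        refine le_trans ?_ hVn
        have h5 : ‖(((Units.mk0 lam hl0)⁻¹ : ℂˣ) : ℂ)‖ ≤ ‖V‖ := h3
        simpa using h5
      rw [norm_inv] at h4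
      exact (inv_le_inv₀ (norm_pos_iff.2 hl0) h0).1 h4
    · rintro ⟨h1, h2⟩
      rw [spectrum.mem_iff]
      rintro ⟨u, hu⟩
      let x : H := (↑u⁻¹ : H →L[ℂ] H) (e 0)
      have hx : lam • x - T x = e 0 := by
        have : ((u : H →L[ℂ] H) * (↑u⁻¹ : H →L[ℂ] H)) (e 0) = e 0 := by simp
        rw [hu] at this
        simpa [x, Algebra.algebraMap_eq_smul_one] using this
      have hc : ∀ n : ℤ, lam * e.repr x (n + 1) - β n * e.repr x n
          = if n + 1 = 0 then 1 else 0 := by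
        intro n
        have := congrArg (fun y => e.repr y (n + 1)) hx
        simp only [map_sub, map_smul, lp.coeFn_sub, lp.coeFn_smul, Pi.sub_apply, Pi.smul_apply,
          smul_eq_mul, hTc] at this
        rw [this, e.repr_self]
        simp [lp.single_apply, Pi.single_apply]
      have ht : Filter.Tendsto (fun n => ‖e.repr x n‖ ^ 2) Filter.cofinite (nhds 0) :=
        (aux_sq e x).summable.tendsto_cofinite_zero
      have key : ∀ (g : ℕ → ℤ), Function.Injective g →
          (∀ k, ‖e.repr x (g k)‖ ≤ ‖e.repr x (g (k + 1))‖) → e.repr x (g 0) = 0 := by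
        intro g hg hm
        have hm' : Monotone (fun k => ‖e.repr x (g k)‖) := monotone_nat_of_le_succ hm
        have h := ht.comp (hg.tendsto_cofinite)
        rw [Nat.cofinite_eq_atTop] at h
        have : ‖e.repr x (g 0)‖ ^ 2 ≤ 0 := by
          refine ge_of_tendsto h (Filter.Eventually.of_forall fun k => ?_)
          exact pow_le_pow_left₀ (norm_nonneg _) (hm' (Nat.zero_le k)) 2
        have : ‖e.repr x (g 0)‖ = 0 := by
          have := norm_nonneg (e.repr x (g 0))
          nlinarith
        simpa using this
      have hA : lam * e.repr x 0 = 0 := by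
        by_cases hl0 : lam = 0
        · simp [hl0]
        have := key (fun k => (k : ℤ)) Nat.cast_injective ?_
        · simp only [Nat.cast_zero] at this
          rw [this, mul_zero]
        intro k
        have h := hc k
        rw [if_neg (by omega), hβpos _ (by omega), sub_eq_zero] at h
        have h' := congrArg norm h
        rw [norm_mul, norm_mul, Complex.norm_real, Real.norm_of_nonneg hR0] at h'
        have hl : 0 < ‖lam‖ := norm_pos_iff.2 hl0
        push_cast
        refine le_of_mul_le_mul_left ?_ hl
        rw [h']
        gcongr
      have hB : (r : ℂ) * e.repr x (-1) = 0 := by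
        rcases hr.eq_or_lt with h0 | h0
        · simp [← h0]
        have := key (fun k => -1 - (k : ℤ)) (fun a b h => by simpa using h) ?_
        · simp only [Nat.cast_zero, sub_zero] at this
          rw [this, mul_zero]
        intro k
        have h := hc (-1 - ((k + 1 : ℕ) : ℤ))
        rw [if_neg (by omega), hβneg _ (by omega), sub_eq_zero] at h
        have h' := congrArg norm h
        rw [norm_mul, norm_mul, Complex.norm_real, Real.norm_of_nonneg hr,
          show -1 - ((k + 1 : ℕ) : ℤ) + 1 = -1 - (k : ℤ) by push_cast; ring] at h'
        refine le_of_mul_le_mul_left ?_ h0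
        rw [← h']
        gcongr
      have h := hc (-1)
      rw [hβneg _ (by norm_num), hB] at h
      simp [hA] at h

end Aux

/-- Every closed annulus centered at the origin is the spectrum of some hyponormal
bilateral weighted shift, and every closed annulus is the spectrum of some
hyponormal operator `T + β I` with `T` a hyponormal bilateral weighted shift. -/
theorem closed_annulus_is_spectrum_of_hyponormal_bilateral_weighted_shift
    {H : Type*} [NormedAddCommGroup H] [InnerProductSpace ℂ H] [CompleteSpace H]
    (e : HilbertBasis ℤ ℂ H) :
    (∀ r R : ℝ, 0 ≤ r → r ≤ R →
        ∃ (T : H →L[ℂ] H) (β : ℤ → ℂ),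
          (∀ n : ℤ, T (e n) = β n • e (n + 1)) ∧
          (∀ n : ℤ, ‖β n‖ ≤ ‖β (n + 1)‖) ∧
          spectrum ℂ T = {lam : ℂ | r ≤ ‖lam‖ ∧ ‖lam‖ ≤ R}) ∧
      (∀ (b : ℂ) (r R : ℝ), 0 ≤ r → r ≤ R →
        ∃ (T : H →L[ℂ] H) (β : ℤ → ℂ),
          (∀ n : ℤ, T (e n) = β n • e (n + 1)) ∧
          (∀ n : ℤ, ‖β n‖ ≤ ‖β (n + 1)‖) ∧
          (∀ x : H,
            ‖ContinuousLinearMap.adjoint (T + b • (1 : H →L[ℂ] H)) x‖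
              ≤ ‖(T + b • (1 : H →L[ℂ] H)) x‖) ∧
          spectrum ℂ (T + b • (1 : H →L[ℂ] H))
            = {lam : ℂ | r ≤ ‖lam - b‖ ∧ ‖lam - b‖ ≤ R}) := by
  refine ⟨fun r R hr hR => ?_, fun b r R hr hR => ?_⟩
  · obtain ⟨T, β, h1, h2, _, h4⟩ := aux_main e r R hr hR
    exact ⟨T, β, h1, h2, h4⟩
  · obtain ⟨T, β, h1, h2, h3, h4⟩ := aux_main e r R hr hR
    refine ⟨T, β, h1, h2, aux_hypo T b h3, ?_⟩
    ext lam
    have h5 : lam ∈ spectrum ℂ (T + b • (1 : H →L[ℂ] H)) ↔ lam - b ∈ spectrum ℂ T := by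
      rw [spectrum.mem_iff, spectrum.mem_iff, Algebra.algebraMap_eq_smul_one,
        Algebra.algebraMap_eq_smul_one, sub_smul, sub_add_eq_sub_sub, sub_right_comm]
    rw [h5, h4]
    rfl
end
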